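/- Let T > 0, K : [0,T] → ℝ continuous, λ > 0, and let ζ : [0,T] → ℝ be the twice continuously differentiable solution of ζ''(t) = −λ²·ζ(t) + ∫₀ᵗ K(t−s) ζ(s) ds with ζ(0)=0, ζ'(0)=1. Define the complex-valued function Z(t) = ζ'(t) + i·λ·ζ(t) and Q(s) = ∫₀ˢ K(s−τ) sin(λτ) dτ. Then for every t ∈ [0,T]: Z(t) = e^{iλt} + (1/λ) ∫₀ᵗ Q(t−s) Z(s) ds. -/

import Mathlib

open MeasureTheory Set

/-- The convolution `(F ∗ G)(t) = ∫₀ᵗ F (t - s) G s ds` on a half-line. -/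
noncomputable def volterraConv (F G : ℝ → ℝ) (t : ℝ) : ℝ := ∫ s in (0 : ℝ)..t, F (t - s) * G s

theorem volterraConv_comm (F G : ℝ → ℝ) (t : ℝ) : volterraConv F G t = volterraConv G F t := by
  have h := intervalIntegral.integral_comp_sub_left (a := 0) (b := t)
    (fun s => F s * G (t - s)) t
  simp only [sub_sub_cancel, sub_zero, sub_self] at h
  rw [volterraConv, volterraConv, h]
  simp only [mul_comm]

theorem volterraConv_congr {T : ℝ} {F F' G G' : ℝ → ℝ} (hF : EqOn F F' (Icc 0 T))
    (hG : EqOn G G' (Icc 0 T)) : EqOn (volterraConv F G) (volterraConv F' G') (Icc 0 T) := by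
  intro t ht
  refine intervalIntegral.integral_congr fun s hs => ?_
  rw [uIcc_of_le ht.1] at hs
  simp only [hF ⟨sub_nonneg.2 hs.2, (sub_le_self t hs.1).trans ht.2⟩, hG ⟨hs.1, hs.2.trans ht.2⟩]

theorem Continuous.volterraConv {F G : ℝ → ℝ} (hF : Continuous F) (hG : Continuous G) :
    Continuous (volterraConv F G) := by
  unfold _root_.volterraConv
  exact intervalIntegral.continuous_parametric_intervalIntegral_of_continuous
    (f := fun t s => F (t - s) * G s) (by fun_prop) continuous_id

theorem ContinuousOn.exists_continuous_eqOn_Icc {T : ℝ} (hT : 0 ≤ T) {F : ℝ → ℝ}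
    (hF : ContinuousOn F (Icc 0 T)) : ∃ G, Continuous G ∧ EqOn F G (Icc 0 T) :=
  ⟨IccExtend hT ((Icc 0 T).domRestrict F), (continuousOn_iff_continuous_domRestrict.1 hF).Icc_extend',
    fun _ hx => by rw [IccExtend_of_mem hT _ hx, domRestrict_apply]⟩

theorem ContinuousOn.volterraConv {T : ℝ} (hT : 0 ≤ T) {F G : ℝ → ℝ}
    (hF : ContinuousOn F (Icc 0 T)) (hG : ContinuousOn G (Icc 0 T)) :
    ContinuousOn (volterraConv F G) (Icc 0 T) := by
  obtain ⟨F', hF', hFF⟩ := hF.exists_continuous_eqOn_Icc hT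
  obtain ⟨G', hG', hGG⟩ := hG.exists_continuous_eqOn_Icc hT
  exact (hF'.volterraConv hG').continuousOn.congr (volterraConv_congr hFF hGG)

/-- Exchanging the order of integration over the triangle `r + s ≤ t`, `0 ≤ r, s`. -/
theorem integral_integral_triangle_swap {f : ℝ → ℝ → ℝ} (hf : Continuous (Function.uncurry f))
    {t : ℝ} (ht : 0 ≤ t) :
    ∫ s in (0 : ℝ)..t, ∫ r in (0 : ℝ)..(t - s), f s r =
      ∫ r in (0 : ℝ)..t, ∫ s in (0 : ℝ)..(t - r), f s r := by
  have key : ∀ g : ℝ → ℝ → ℝ, ∫ s in (0 : ℝ)..t, ∫ r in (0 : ℝ)..(t - s), g s r =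
      ∫ s in Ioc 0 t, ∫ r in Ioc 0 t, {p : ℝ × ℝ | p.1 + p.2 ≤ t}.indicator
        (Function.uncurry g) (s, r) := by
    intro g
    rw [intervalIntegral.integral_of_le ht]
    refine setIntegral_congr_fun measurableSet_Ioc fun s hs => ?_
    have h : ∀ r, {p : ℝ × ℝ | p.1 + p.2 ≤ t}.indicator (Function.uncurry g) (s, r) =
        (Iic (t - s)).indicator (g s) r := fun r => by
      simp only [indicator, mem_ofPred_eq, mem_Iic, le_sub_iff_add_le', Function.uncurry_apply_pair]
    simp only [h]
    rw [intervalIntegral.integral_of_le (sub_nonneg.2 hs.2), setIntegral_indicator measurableSet_Iic,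
      Ioc_inter_Iic, min_eq_right (sub_le_self t hs.1.le)]
  rw [key, key fun r s => f s r, integral_integral_swap]
  · refine integral_congr_ae (.of_forall fun r => integral_congr_ae (.of_forall fun s => ?_))
    simp only [indicator, mem_ofPred_eq, Function.uncurry_apply_pair, add_comm]
  · have hm : MeasurableSet {p : ℝ × ℝ | p.1 + p.2 ≤ t} :=
      (isClosed_le (by fun_prop) continuous_const).measurableSet
    refine Integrable.indicator ?_ hm
    rw [Measure.prod_restrict]
    exact (hf.continuousOn.integrableOn_compact (isCompact_Icc.prod isCompact_Icc)).mono_set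
      (prod_mono Ioc_subset_Icc_self Ioc_subset_Icc_self)

theorem volterraConv_assoc {T : ℝ} {F G H : ℝ → ℝ} (hF : ContinuousOn F (Icc 0 T))
    (hG : ContinuousOn G (Icc 0 T)) (hH : ContinuousOn H (Icc 0 T)) :
    EqOn (volterraConv (volterraConv F G) H) (volterraConv F (volterraConv G H)) (Icc 0 T) := by
  intro t ht
  obtain ⟨F', hF', hFF⟩ := hF.exists_continuous_eqOn_Icc (ht.1.trans ht.2)
  obtain ⟨G', hG', hGG⟩ := hG.exists_continuous_eqOn_Icc (ht.1.trans ht.2)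
  obtain ⟨H', hH', hHH⟩ := hH.exists_continuous_eqOn_Icc (ht.1.trans ht.2)
  rw [volterraConv_congr (volterraConv_congr hFF hGG) hHH ht,
    volterraConv_congr hFF (volterraConv_congr hGG hHH) ht, volterraConv_comm F']
  have h := integral_integral_triangle_swap (f := fun s r => G' (t - s - r) * F' r * H' s)
    (by simp only [Function.uncurry_def]; fun_prop) ht.1
  have hl : ∀ s, volterraConv F' G' s = volterraConv G' F' s := fun s => volterraConv_comm ..
  unfold volterraConv at *
  simp only [hl, ← intervalIntegral.integral_mul_const]
  rw [h]
  refine intervalIntegral.integral_congr fun r _ => intervalIntegral.integral_congr fun s _ => ?_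
  simp only [sub_right_comm t s r]
  ring

theorem ContinuousOn.comp_const_sub_Icc {T t : ℝ} {F : ℝ → ℝ} (hF : ContinuousOn F (Icc 0 T))
    (ht : t ∈ Icc 0 T) : ContinuousOn (fun s => F (t - s)) (Icc 0 t) :=
  hF.comp (by fun_prop) fun _ hs => ⟨sub_nonneg.2 hs.2, (sub_le_self t hs.1).trans ht.2⟩

theorem integral_eq_sub_of_hasDerivWithinAt_Icc {T t : ℝ} (ht : t ∈ Icc 0 T) {u v : ℝ → ℝ}
    (hu : ∀ s ∈ Icc 0 T, HasDerivWithinAt u (v s) (Icc 0 T) s) (hv : ContinuousOn v (Icc 0 t)) :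
    ∫ s in (0 : ℝ)..t, v s = u t - u 0 := by
  have hsub : Icc 0 t ⊆ Icc 0 T := Icc_subset_Icc_right ht.2
  exact intervalIntegral.integral_eq_sub_of_hasDerivAt_of_le ht.1
    (fun s hs => ((hu s (hsub hs)).mono hsub).continuousWithinAt)
    (fun s hs => (hu s (hsub (Ioo_subset_Icc_self hs))).hasDerivAt
      (Icc_mem_nhds hs.1 (hs.2.trans_le ht.2)))
    (hv.intervalIntegrable_of_Icc ht.1)

theorem stmt13 (T : ℝ) (hT : 0 < T) (K : ℝ → ℝ) (hK : ContinuousOn K (Set.Icc 0 T))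
    (lam : ℝ) (hlam : 0 < lam)
    (ζ ζd ζdd : ℝ → ℝ)
    (hζ1 : ∀ t ∈ Set.Icc 0 T, HasDerivWithinAt ζ (ζd t) (Set.Icc 0 T) t)
    (hζ2 : ∀ t ∈ Set.Icc 0 T, HasDerivWithinAt ζd (ζdd t) (Set.Icc 0 T) t)
    (hζ3 : ContinuousOn ζdd (Set.Icc 0 T))
    (hζ0 : ζ 0 = 0) (hζd0 : ζd 0 = 1)
    (hζeq : ∀ t ∈ Set.Icc 0 T,
      ζdd t = -lam ^ 2 * ζ t + ∫ s in (0:ℝ)..t, K (t - s) * ζ s)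
    (Q : ℝ → ℝ)
    (hQ : ∀ s, Q s = ∫ τ in (0:ℝ)..s, K (s - τ) * Real.sin (lam * τ))
    (Z : ℝ → ℂ)
    (hZ : ∀ t, Z t = (ζd t : ℂ) + Complex.I * (lam : ℂ) * (ζ t : ℂ)) :
    ∀ t ∈ Set.Icc 0 T,
      Z t = Complex.exp (Complex.I * (lam : ℂ) * (t : ℂ)) +
        (1 / (lam : ℂ)) * ∫ s in (0:ℝ)..t, (Q (t - s) : ℂ) * Z s := by
  have hcζ : ContinuousOn ζ (Icc 0 T) := fun t ht => (hζ1 t ht).continuousWithinAt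
  have hcζd : ContinuousOn ζd (Icc 0 T) := fun t ht => (hζ2 t ht).continuousWithinAt
  set S : ℝ → ℝ := fun s => Real.sin (lam * s) with hS
  set C : ℝ → ℝ := fun s => Real.cos (lam * s) with hC
  have hcS : ContinuousOn S (Icc 0 T) := by fun_prop
  have hcC : ContinuousOn C (Icc 0 T) := by fun_prop
  have hdS : ∀ t s, HasDerivAt (fun s => S (t - s)) (-(lam * C (t - s))) s := fun t s => by
    have := (((hasDerivAt_id s).const_sub t).const_mul lam).sin
    exact this.congr_deriv (by simp [hC]; ring)
  have hdC : ∀ t s, HasDerivAt (fun s => C (t - s)) (lam * S (t - s)) s := fun t s => by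
    have := (((hasDerivAt_id s).const_sub t).const_mul lam).cos
    exact this.congr_deriv (by simp [hS]; ring)
  have hf : EqOn (volterraConv K ζ) (fun s => ζdd s + lam ^ 2 * ζ s) (Icc 0 T) := fun t ht => by
    simp only [hζeq t ht, volterraConv]; ring
  obtain rfl : Q = volterraConv K S := funext hQ
  have hcQ : ContinuousOn (volterraConv K S) (Icc 0 T) := hK.volterraConv hT.le hcS
  have hSf : EqOn (volterraConv S (volterraConv K ζ)) (fun t => lam * ζ t - S t) (Icc 0 T) := by
    intro t ht
    have hsub : Icc 0 t ⊆ Icc 0 T := Icc_subset_Icc_right ht.2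
    rw [volterraConv_congr (fun _ _ => rfl) hf ht, volterraConv,
      integral_eq_sub_of_hasDerivWithinAt_Icc ht
        (u := fun s => S (t - s) * ζd s + lam * (C (t - s) * ζ s))]
    · simp [hS, hC, hζ0, hζd0]
    · intro s hs
      exact (((hdS t s).hasDerivWithinAt.mul (hζ2 s hs)).add
        (((hdC t s).hasDerivWithinAt.mul (hζ1 s hs)).const_mul lam)).congr_deriv (by ring)
    · exact (hcS.comp_const_sub_Icc ht).mul
        ((hζ3.mono hsub).add ((hcζ.mono hsub).const_smul (lam ^ 2)))
  have hCf : EqOn (volterraConv C (volterraConv K ζ)) (fun t => ζd t - C t) (Icc 0 T) := by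
    intro t ht
    have hsub : Icc 0 t ⊆ Icc 0 T := Icc_subset_Icc_right ht.2
    rw [volterraConv_congr (fun _ _ => rfl) hf ht, volterraConv,
      integral_eq_sub_of_hasDerivWithinAt_Icc ht
        (u := fun s => C (t - s) * ζd s - lam * (S (t - s) * ζ s))]
    · simp [hS, hC, hζ0, hζd0]
    · intro s hs
      exact (((hdC t s).hasDerivWithinAt.mul (hζ2 s hs)).sub
        (((hdS t s).hasDerivWithinAt.mul (hζ1 s hs)).const_mul lam)).congr_deriv (by ring)
    · exact (hcC.comp_const_sub_Icc ht).mul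
        ((hζ3.mono hsub).add ((hcζ.mono hsub).const_smul (lam ^ 2)))
  have hSζd : EqOn (volterraConv S ζd) (volterraConv C fun s => lam * ζ s) (Icc 0 T) := by
    intro t ht
    have hsub : Icc 0 t ⊆ Icc 0 T := Icc_subset_Icc_right ht.2
    have h1 : ContinuousOn (fun s => S (t - s) * ζd s) (Icc 0 t) :=
      (hcS.comp_const_sub_Icc ht).mul (hcζd.mono hsub)
    have h2 : ContinuousOn (fun s => C (t - s) * (lam * ζ s)) (Icc 0 t) :=
      (hcC.comp_const_sub_Icc ht).mul ((hcζ.mono hsub).const_smul lam)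
    rw [← sub_eq_zero, volterraConv, volterraConv, ← intervalIntegral.integral_sub
      (h1.intervalIntegrable_of_Icc ht.1) (h2.intervalIntegrable_of_Icc ht.1),
      integral_eq_sub_of_hasDerivWithinAt_Icc ht
        (u := fun s => S (t - s) * ζ s)
        (v := fun s => S (t - s) * ζd s - C (t - s) * (lam * ζ s))
        ?_ (h1.sub h2)]
    · simp [hS, hζ0]
    · intro s hs
      exact ((hdS t s).hasDerivWithinAt.mul (hζ1 s hs)).congr_deriv (by ring)
  intro t ht
  have hQζ : volterraConv (volterraConv K S) ζ t = lam * ζ t - S t := by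
    rw [funext (volterraConv_comm K S), volterraConv_assoc hcS hK hcζ ht, hSf ht]
  have hQζd : volterraConv (volterraConv K S) ζd t = lam * (ζd t - C t) := by
    have hsm : ∀ F G : ℝ → ℝ, volterraConv F (fun s => lam * G s) t = lam * volterraConv F G t :=
      fun F G => by
        simp only [volterraConv, ← intervalIntegral.integral_const_mul, mul_left_comm]
    rw [volterraConv_assoc hK hcS hcζd ht, volterraConv_congr (fun _ _ => rfl) hSζd ht,
      ← volterraConv_assoc hK hcC (H := fun s => lam * ζ s) (hcζ.const_smul lam) ht,
      hsm,
      funext (volterraConv_comm K C), volterraConv_assoc hcC hK hcζ ht, hCf ht]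
  have hsub : Icc 0 t ⊆ Icc 0 T := Icc_subset_Icc_right ht.2
  have hi : ∀ G : ℝ → ℝ, ContinuousOn G (Icc 0 T) → IntervalIntegrable
      (fun s => ((volterraConv K S (t - s) * G s : ℝ) : ℂ)) volume 0 t := fun G hG =>
    (Complex.continuous_ofReal.comp_continuousOn ((hcQ.comp_const_sub_Icc ht).mul
      (hG.mono hsub))).intervalIntegrable_of_Icc ht.1
  have hint : ∫ s in (0 : ℝ)..t, (volterraConv K S (t - s) : ℂ) * Z s =
      (volterraConv (volterraConv K S) ζd t : ℂ) +
        Complex.I * lam * (volterraConv (volterraConv K S) ζ t : ℂ) := by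
    rw [volterraConv, volterraConv, ← intervalIntegral.integral_ofReal,
      ← intervalIntegral.integral_ofReal, ← intervalIntegral.integral_const_mul,
      ← intervalIntegral.integral_add (hi ζd hcζd) ((hi ζ hcζ).const_mul _)]
    refine intervalIntegral.integral_congr fun s _ => ?_
    simp only [hZ]
    push_cast
    ring
  have hl : (lam : ℂ) ≠ 0 := by exact_mod_cast hlam.ne'
  have he : Complex.exp (Complex.I * lam * t) = (C t : ℂ) + (S t : ℂ) * Complex.I := by
    rw [mul_assoc, mul_comm, Complex.exp_mul_I]
    simp [hS, hC]
  rw [hint, hQζ, hQζd, hZ, he]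
  push_cast
  field_simp
  ring
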